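/- Let M = (S, A, T, R, γ) be a finite MDP, let Q* : S → A → ℝ satisfy the Bellman optimality equation for M, and let π* : S → A be greedy with respect to Q*. Let φ : (A → ℕ) → ℝ be any potential function on action-count vectors, and consider the shaped augmented MDP on Ŝ = S × (A → ℕ) with transitions T̂ (s,g) a (s',g') = T s a s' if g' = g + e_a (else 0) and reward R̂ (s,g) a (s',g') + F (s,g) (s',g'), where R̂ (s,g) a (s',g') = R s a s' if g' = g + e_a (else 0) and the shaping reward is F (s,g) (s',g') = γ * φ g' − φ g. Then Q̂' defined by Q̂' (s,g) a = Q* s a − φ g satisfies the Bellman optimality equation for the shaped augmented MDP (with tsums over next augmented states, which have finite support), and the lifted policy π̂ (s,g) = π* s is greedy with respect to Q̂': Q̂' (s,g) (π̂ (s,g)) = max_{a ∈ A} Q̂' (s,g) a for all (s,g) ∈ Ŝ. -/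

import Mathlib

/-- The augmented transition function on `S × (A → ℕ)`:
`T̂ (s,g) a (s',g') = T s a s'` if `g' = g + e_a`, and `0` otherwise. -/
def augT {S A : Type*} [Fintype A] [DecidableEq A]
    (T : S → A → S → ℝ) : (S × (A → ℕ)) → A → (S × (A → ℕ)) → ℝ :=
  fun p a p' =>
    if p'.2 = p.2 + (fun b => if b = a then 1 else 0) then T p.1 a p'.1 else 0

/-- The augmented reward function on `S × (A → ℕ)`:
`R̂ (s,g) a (s',g') = R s a s'` if `g' = g + e_a`, and `0` otherwise. -/
def augR {S A : Type*} [Fintype A] [DecidableEq A]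
    (R : S → A → S → ℝ) : (S × (A → ℕ)) → A → (S × (A → ℕ)) → ℝ :=
  fun p a p' =>
    if p'.2 = p.2 + (fun b => if b = a then 1 else 0) then R p.1 a p'.1 else 0

/-- Subtracting a constant commutes with taking a finite maximum. -/
theorem Finset.sup'_sub_const {ι : Type*} (s : Finset ι) (hs : s.Nonempty) (f : ι → ℝ) (c : ℝ) :
    s.sup' hs (fun i => f i - c) = s.sup' hs f - c :=
  (Finset.apply_sup'_eq_sup'_comp hs (fun x => x - c)
    (fun x y => (max_sub_sub_right x y c).symm)).symm

/-- A sum weighted by the augmented transition function reduces to a finite sum over next states. -/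
theorem tsum_augT_mul {S A : Type*} [Fintype S] [Fintype A] [DecidableEq A]
    (T : S → A → S → ℝ) (p : S × (A → ℕ)) (a : A) (f : S × (A → ℕ) → ℝ) :
    ∑' p' : S × (A → ℕ), augT T p a p' * f p' =
      ∑ s', T p.1 a s' * f (s', p.2 + (fun b => if b = a then 1 else 0)) := by
  have hinj : Function.Injective
      (fun s' : S => (s', p.2 + (fun b : A => if b = a then 1 else 0))) :=
    fun _ _ h => congrArg Prod.fst h
  have hsupp : Function.support (fun p' => augT T p a p' * f p') ⊆
      Set.range (fun s' : S => (s', p.2 + (fun b : A => if b = a then 1 else 0))) := by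
    rintro ⟨s', g'⟩ h
    by_cases hg : g' = p.2 + (fun b => if b = a then 1 else 0)
    · exact ⟨s', by rw [hg]⟩
    · exact absurd (by simp [augT, hg]) h
  rw [← hinj.tsum_eq hsupp, tsum_fintype]
  simp [augT]

/-- Shaping the augmented MDP with a potential `φ` depending only on the
action-count component: `Q̂' (s,g) a = Q* s a − φ g` satisfies the Bellman
optimality equation for the shaped augmented MDP whose reward is
`R̂ (s,g) a (s',g') + (γ * φ g' − φ g)`, and the lifted policy `π̂ (s,g) = π* s`
is greedy with respect to `Q̂'`. -/
theorem shaped_augmented_bellman_and_greedy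
    {S A : Type*} [Fintype S] [Nonempty S] [Fintype A] [Nonempty A] [DecidableEq A]
    (T : S → A → S → ℝ) (R : S → A → S → ℝ) (γ : ℝ)
    (hT_nonneg : ∀ s a s', 0 ≤ T s a s')
    (hT_sum : ∀ s a, ∑ s', T s a s' = 1)
    (hγ_nonneg : 0 ≤ γ) (hγ_lt : γ < 1)
    (Q : S → A → ℝ)
    (hQ : ∀ s a, Q s a = ∑ s', T s a s' *
      (R s a s' + γ * Finset.univ.sup' Finset.univ_nonempty (fun a' => Q s' a')))
    (π : S → A)
    (hπ : ∀ s, Q s (π s) = Finset.univ.sup' Finset.univ_nonempty (fun a => Q s a))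
    (φ : (A → ℕ) → ℝ) :
    (∀ (p : S × (A → ℕ)) (a : A),
      Q p.1 a - φ p.2 = ∑' p' : S × (A → ℕ), augT T p a p' *
        ((augR R p a p' + (γ * φ p'.2 - φ p.2)) +
          γ * Finset.univ.sup' Finset.univ_nonempty (fun a' => Q p'.1 a' - φ p'.2))) ∧
    (∀ p : S × (A → ℕ),
      Q p.1 (π p.1) - φ p.2 =
        Finset.univ.sup' Finset.univ_nonempty (fun a => Q p.1 a - φ p.2)) := by
  refine ⟨fun p a => ?_, fun p => by rw [Finset.sup'_sub_const, hπ]⟩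
  rw [tsum_augT_mul]
  simp only [augR, if_true, Finset.sup'_sub_const]
  calc Q p.1 a - φ p.2
      = Q p.1 a - (∑ s', T p.1 a s') * φ p.2 := by rw [hT_sum, one_mul]
    _ = _ := by
      rw [hQ, Finset.sum_mul, ← Finset.sum_sub_distrib]
      exact Finset.sum_congr rfl fun _ _ => by ring
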